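/- Suppose there are sequences a_n, b_n > 0 with a_n^{−1/2}/(A n^a) → 1 and b_n/(B n^b) → 1 for some constants A, B, b > 0 and a ∈ ℝ, and ν > −1 with 2a+1 = b(ν+1). Assume for j = 0 and j = 1, uniformly on compact subsets of ℂ, (−1)^n (a_n^{1/2}/b_n^{j/2}) · p_n^{[j]}(c + z²/b_n) → φ_{ν+j}(z), and that the leading coefficients satisfy lim_n (γ_n/γ_n^{[1]}) · b_n^{1/2}/n = 1/b and lim_n (γ_n^{[1]}/γ_{n+1}) · b_n^{1/2}/n = 1/b, where γ_n = γ_n^{[0]} and γ_n^{[j]} is the leading coefficient of p_n^{[j]}. Then for every integer j ≥ 0, uniformly on compact subsets of ℂ, (−1)^n (a_n^{1/2}/b_n^{j/2}) · p_n^{[j]}(c + z²/b_n) → φ_{ν+j}(z). -/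

import Mathlib

open MeasureTheory Polynomial Filter Topology

noncomputable section

/-- The support of a Borel measure on `ℝ`. -/
def measSupport (μ : Measure ℝ) : Set ℝ := {x | ∀ U ∈ nhds x, μ U ≠ 0}

/-- `P` is a sequence of orthonormal polynomials with respect to the measure `μ`. -/
def IsOPS (μ : Measure ℝ) (P : ℕ → Polynomial ℝ) : Prop :=
  (∀ n, (P n).degree = n) ∧ (∀ n, 0 < (P n).leadingCoeff) ∧
    ∀ n m, (∫ x, (P n).eval x * (P m).eval x ∂μ) = if n = m then 1 else 0

/-- The modified measure `dμ_j(x) = (x-c)^j dμ(x)`. -/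
def muMod (μ : Measure ℝ) (c : ℝ) (j : ℕ) : Measure ℝ :=
  μ.withDensity fun x => ENNReal.ofReal ((x - c) ^ j)

/-- `φ_ν(z) = Σ_{k≥0} (-1)^k z^{2k} / (k! Γ(k+ν+1)) = z^{-ν} J_ν(2z)`. -/
def phi (ν : ℝ) (z : ℂ) : ℂ :=
  ∑' k : ℕ, ((-1 : ℂ) ^ k * z ^ (2 * k)) /
    ((k.factorial : ℂ) * Complex.Gamma ((k : ℂ) + (ν : ℂ) + 1))

/-- Coefficient of `z ^ (2 * m)` in the power series `phi ν`. -/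
def phiCoeff (ν : ℝ) (m : ℕ) : ℝ :=
  (-1) ^ m / ((m.factorial : ℝ) * Real.Gamma (m + ν + 1))

/-- Each column of `V` converges to the corresponding entry of `ψ`, and the rows of `V` are
uniformly bounded in every weighted supremum norm `sup_m |V n m| R ^ m`. -/
def CoeffTendsto (V : ℕ → ℕ → ℝ) (ψ : ℕ → ℝ) : Prop :=
  (∀ m, Tendsto (fun n => V n m) atTop (𝓝 (ψ m))) ∧
    ∀ R : ℝ, 0 ≤ R → ∃ C, ∀ n m, |V n m| * R ^ m ≤ C

theorem phi_eq_tsum (ν : ℝ) (z : ℂ) :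
    phi ν z = ∑' m : ℕ, (phiCoeff ν m : ℂ) * (z ^ 2) ^ m := by
  unfold phi phiCoeff
  refine tsum_congr fun m => ?_
  push_cast
  rw [← Complex.Gamma_ofReal, pow_mul]
  push_cast
  ring

theorem phiCoeff_succ {ν : ℝ} (hν : -1 < ν) (m : ℕ) :
    phiCoeff ν (m + 1) = -phiCoeff ν m / ((m + 1) * (m + ν + 1)) := by
  have h : (0 : ℝ) < m + ν + 1 := by
    have : (0 : ℝ) ≤ m := m.cast_nonneg
    linarith
  have hG := Real.Gamma_pos_of_pos h
  have hF : (0 : ℝ) < m.factorial := by exact_mod_cast m.factorial_pos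
  unfold phiCoeff
  push_cast [Nat.factorial_succ]
  rw [show (m : ℝ) + 1 + ν + 1 = (m + ν + 1) + 1 by ring, Real.Gamma_add_one h.ne']
  field_simp
  ring

theorem summable_phiCoeff {ν : ℝ} (hν : -1 < ν) (R : ℝ) :
    Summable fun m => phiCoeff ν m * R ^ m := by
  refine summable_of_ratio_norm_eventually_le (r := 1 / 2) (by norm_num) ?_
  filter_upwards [eventually_ge_atTop (⌈2 * |R|⌉₊ + 1)] with m hm
  have h1 : (⌈2 * |R|⌉₊ : ℝ) + 1 ≤ m := by exact_mod_cast hm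
  have h2 := Nat.le_ceil (2 * |R|)
  have h3 : 2 * |R| ≤ (m + 1) * (m + ν + 1) := by
    nlinarith [abs_nonneg R]
  have h4 : 0 < (m + 1) * (m + ν + 1) := by
    have := abs_nonneg R
    apply mul_pos <;> linarith
  rw [phiCoeff_succ hν, pow_succ, Real.norm_eq_abs, Real.norm_eq_abs, abs_mul, abs_div, abs_neg,
    abs_of_pos h4, abs_mul, abs_mul, div_mul_eq_mul_div, div_le_iff₀ h4]
  have := mul_nonneg (abs_nonneg (phiCoeff ν m)) (abs_nonneg (R ^ m))
  nlinarith

theorem phiCoeff_step {ν : ℝ} (hν : -1 < ν) (m : ℕ) :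
    phiCoeff (ν + 2) m = -phiCoeff ν (m + 1) * (m + 1) / (m + ν + 2) := by
  have h : (0 : ℝ) < m + ν + 2 := by
    have : (0 : ℝ) ≤ m := m.cast_nonneg
    linarith
  have hG := Real.Gamma_pos_of_pos h
  have hF : (0 : ℝ) < m.factorial := by exact_mod_cast m.factorial_pos
  unfold phiCoeff
  push_cast [Nat.factorial_succ]
  rw [show (m : ℝ) + (ν + 2) + 1 = (m + ν + 2) + 1 by ring, Real.Gamma_add_one h.ne',
    show (m : ℝ) + 1 + ν + 1 = m + ν + 2 by ring]
  field_simp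
  ring

/-- Cauchy's estimate for the coefficients of an entire power series. -/
theorem norm_coeff_mul_pow_le {d : ℕ → ℂ} {f : ℂ → ℂ}
    (hd : ∀ w, HasSum (fun m => d m * w ^ m) (f w)) {R ε : ℝ} (hR : 0 < R)
    (hf : ∀ w, ‖w‖ = R → ‖f w‖ ≤ ε) (m : ℕ) : ‖d m‖ * R ^ m ≤ ε := by
  have hp : HasFPowerSeriesOnBall f (FormalMultilinearSeries.ofScalars ℂ d) 0 ⊤ := by
    refine ⟨?_, by simp, fun {y} _ => ?_⟩
    · rw [top_le_iff, FormalMultilinearSeries.radius_eq_top_iff_summable_norm]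
      intro r
      have := (hd r).summable.norm
      simpa [FormalMultilinearSeries.ofScalars_norm] using this
    · simpa [FormalMultilinearSeries.ofScalars_apply_eq, mul_comm] using hd y
  have hdiff : Differentiable ℂ f := by
    have := hp.differentiableOn
    simpa [differentiableOn_univ] using this
  have h1 := Complex.norm_iteratedDeriv_le_of_forall_mem_sphere_norm_le (c := 0) m hR
    hdiff.diffContOnCl (fun z hz => hf z (by simpa using hz))
  have h2 := hp.factorial_smul 1 m
  rw [← iteratedDeriv_eq_iteratedFDeriv] at h2
  rw [← h2] at h1
  simp at h1
  have h3 : (0 : ℝ) < m.factorial := by exact_mod_cast m.factorial_pos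
  rw [mul_div_assoc, mul_le_mul_iff_right₀ h3, le_div_iff₀ (by positivity)] at h1
  exact h1

theorem hasSum_phi {ν : ℝ} (hν : -1 < ν) (z : ℂ) :
    HasSum (fun m => (phiCoeff ν m : ℂ) * (z ^ 2) ^ m) (phi ν z) := by
  rw [phi_eq_tsum]
  refine Summable.hasSum (Summable.of_norm ?_)
  have h := (summable_phiCoeff hν (‖z‖ ^ 2)).norm
  simpa using h

theorem hasSum_scaled_taylor (p : ℝ[X]) (c κ b : ℝ) (w : ℂ) :
    HasSum (fun m => ((κ * (taylor c p).coeff m / b ^ m : ℝ) : ℂ) * w ^ m)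
      ((κ : ℂ) * aeval ((c : ℂ) + w / (b : ℂ)) p) := by
  have h : (κ : ℂ) * aeval ((c : ℂ) + w / (b : ℂ)) p =
      ∑ m ∈ Finset.range ((taylor c p).natDegree + 1),
        ((κ * (taylor c p).coeff m / b ^ m : ℝ) : ℂ) * w ^ m := by
    have h1 : aeval ((c : ℂ) + w / (b : ℂ)) p = aeval (w / (b : ℂ)) (taylor c p) := by
      rw [taylor_apply, aeval_comp]
      simp [add_comm]
    rw [h1, aeval_eq_sum_range, Finset.mul_sum]
    refine Finset.sum_congr rfl fun m _ => ?_
    rw [Complex.real_smul]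
    push_cast
    rw [div_pow]
    ring
  rw [h]
  refine hasSum_sum_of_ne_finset_zero (fun m hm => ?_)
  have : (taylor c p).coeff m = 0 := by
    apply coeff_eq_zero_of_natDegree_lt
    rw [Finset.mem_range] at hm
    lia
  simp [this]

/-- Uniform convergence on compact sets yields convergence of coefficients. -/
theorem coeffTendsto_of_tendstoUniformlyOn {ν : ℝ} (hν : -1 < ν) (P : ℕ → ℝ[X]) (c : ℝ)
    (κ b : ℕ → ℝ)
    (h : ∀ K : Set ℂ, IsCompact K → TendstoUniformlyOn
      (fun (n : ℕ) (z : ℂ) => (κ n : ℂ) * aeval ((c : ℂ) + z ^ 2 / (b n : ℂ)) (P n))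
      (phi ν) atTop K) :
    CoeffTendsto (fun n m => κ n * (taylor c (P n)).coeff m / b n ^ m) (phiCoeff ν) := by
  have key : ∀ R : ℝ, 0 < R → ∀ ε : ℝ, 0 < ε → ∀ᶠ n in atTop, ∀ m,
      |κ n * (taylor c (P n)).coeff m / b n ^ m - phiCoeff ν m| * R ^ m ≤ ε := by
    intro R hR ε hε
    have h1 := Metric.tendstoUniformlyOn_iff.1
      (h _ (isCompact_closedBall (0 : ℂ) (Real.sqrt R))) ε hε
    filter_upwards [h1] with n hn m
    have hsq : ∀ w : ℂ, ∃ z : ℂ, z ^ 2 = w := fun w =>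
      IsAlgClosed.exists_pow_nat_eq w (by norm_num)
    choose s hs using hsq
    have h2 : ∀ w, HasSum (fun m => (((κ n * (taylor c (P n)).coeff m / b n ^ m
        - phiCoeff ν m : ℝ)) : ℂ) * w ^ m)
        ((κ n : ℂ) * aeval ((c : ℂ) + w / (b n : ℂ)) (P n) - phi ν (s w)) := by
      intro w
      have h3 := (hasSum_scaled_taylor (P n) c (κ n) (b n) w).sub (hasSum_phi hν (s w))
      rw [hs w] at h3
      refine h3.congr_fun fun m => ?_
      rw [Complex.ofReal_sub, sub_mul]
    have h4 := norm_coeff_mul_pow_le h2 hR (ε := ε) (fun w hw => ?_) m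
    · rwa [Complex.norm_real, Real.norm_eq_abs] at h4
    · have h5 := hn (s w) ?_
      · rw [dist_comm, dist_eq_norm, hs w] at h5
        exact h5.le
      · have h6 : ‖s w‖ ^ 2 = R := by rw [← norm_pow, hs, hw]
        rw [mem_closedBall_zero_iff, ← h6, Real.sqrt_sq (norm_nonneg _)]
  refine ⟨fun m => ?_, fun R hR => ?_⟩
  · rw [Metric.tendsto_atTop]
    intro ε hε
    obtain ⟨N, hN⟩ := eventually_atTop.1 (key 1 one_pos (ε / 2) (half_pos hε))
    refine ⟨N, fun n hn => ?_⟩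
    have := hN n hn m
    rw [Real.dist_eq]
    simp only [one_pow, mul_one] at this
    linarith
  · have hR' : 0 < R + 1 := by linarith
    obtain ⟨N, hN⟩ := eventually_atTop.1 (key (R + 1) hR' 1 one_pos)
    have hmono : ∀ (x : ℝ) (m : ℕ), |x| * R ^ m ≤ |x| * (R + 1) ^ m := fun x m =>
      mul_le_mul_of_nonneg_left (pow_le_pow_left₀ hR (by linarith) m) (abs_nonneg x)
    obtain ⟨C, hC⟩ : ∃ C, ∀ m, |phiCoeff ν m| * (R + 1) ^ m ≤ C := by
      obtain ⟨C, hC⟩ := (summable_phiCoeff hν (R + 1)).tendsto_atTop_zero.norm.bddAbove_range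
      refine ⟨C, fun m => ?_⟩
      have := hC ⟨m, rfl⟩
      simpa [abs_of_pos hR'] using this
    have hrow : ∀ n, ∃ D, ∀ m,
        |κ n * (taylor c (P n)).coeff m / b n ^ m| * (R + 1) ^ m ≤ D := by
      intro n
      have h1 := (hasSum_scaled_taylor (P n) c (κ n) (b n) ((R + 1 : ℝ) : ℂ)).summable
      obtain ⟨D, hD⟩ := h1.tendsto_atTop_zero.norm.bddAbove_range
      refine ⟨D, fun m => ?_⟩
      have := hD ⟨m, rfl⟩
      simp only [norm_mul, norm_pow, Complex.norm_real, Real.norm_eq_abs, abs_of_pos hR'] at this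
      exact this
    choose D hD using hrow
    refine ⟨(1 + C) + ∑ i ∈ Finset.range N, |D i|, fun n m => (hmono _ m).trans ?_⟩
    have hC0 : 0 ≤ C := le_trans (by positivity) (hC 0)
    have hS : 0 ≤ ∑ i ∈ Finset.range N, |D i| := Finset.sum_nonneg fun _ _ => abs_nonneg _
    rcases lt_or_ge n N with hn | hn
    · have h1 : |D n| ≤ ∑ i ∈ Finset.range N, |D i| :=
        Finset.single_le_sum (f := fun i => |D i|) (fun _ _ => abs_nonneg _)
          (Finset.mem_range.2 hn)
      have := hD n m
      have := le_abs_self (D n)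
      linarith
    · have h1 := hN n hn m
      have h2 := hC m
      have h3 : |κ n * (taylor c (P n)).coeff m / b n ^ m| ≤
          |κ n * (taylor c (P n)).coeff m / b n ^ m - phiCoeff ν m| + |phiCoeff ν m| := by
        have := abs_add_le (κ n * (taylor c (P n)).coeff m / b n ^ m - phiCoeff ν m)
          (phiCoeff ν m)
        simpa using this
      have h4 := mul_le_mul_of_nonneg_right h3 (pow_nonneg hR'.le m)
      rw [add_mul] at h4
      linarith

/-- Convergence of coefficients yields uniform convergence on compact sets. -/
theorem tendstoUniformlyOn_of_coeffTendsto {ν : ℝ} (hν : -1 < ν) (P : ℕ → ℝ[X]) (c : ℝ)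
    (κ b : ℕ → ℝ)
    (h : CoeffTendsto (fun n m => κ n * (taylor c (P n)).coeff m / b n ^ m) (phiCoeff ν))
    (K : Set ℂ) (hK : IsCompact K) : TendstoUniformlyOn
      (fun (n : ℕ) (z : ℂ) => (κ n : ℂ) * aeval ((c : ℂ) + z ^ 2 / (b n : ℂ)) (P n))
      (phi ν) atTop K := by
  obtain ⟨r, hr⟩ := hK.isBounded.exists_norm_le
  set R := r ^ 2 with hRdef
  have hR : 0 ≤ R := sq_nonneg r
  obtain ⟨C, hC⟩ := h.2 (2 * R) (by positivity)
  set V := fun n m => κ n * (taylor c (P n)).coeff m / b n ^ m with hV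
  have hCψ : ∀ m, |phiCoeff ν m| * (2 * R) ^ m ≤ C := fun m =>
    le_of_tendsto' ((h.1 m).abs.mul_const _) fun n => hC n m
  have hbound : ∀ n m, |V n m - phiCoeff ν m| * R ^ m ≤ 2 * C * (1 / 2) ^ m := by
    intro n m
    have h1 := hC n m
    have h2 := hCψ m
    have h3 : |V n m - phiCoeff ν m| ≤ |V n m| + |phiCoeff ν m| := abs_sub _ _
    have h4 := mul_le_mul_of_nonneg_right h3 (show 0 ≤ (2 * R) ^ m by positivity)
    have h5 : R ^ m = (2 * R) ^ m * (1 / 2) ^ m := by rw [← mul_pow]; ring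
    rw [h5, ← mul_assoc]
    refine mul_le_mul_of_nonneg_right ?_ (by positivity)
    rw [add_mul] at h4
    linarith
  have hgeo : Summable fun m : ℕ => 2 * C * (1 / 2 : ℝ) ^ m :=
    summable_geometric_two.mul_left _
  have hlim : Tendsto (fun n => ∑' m, |V n m - phiCoeff ν m| * R ^ m) atTop (𝓝 0) := by
    have := tendsto_tsum_of_dominated_convergence (𝓕 := atTop) (g := fun _ : ℕ => (0 : ℝ))
      (f := fun n m => |V n m - phiCoeff ν m| * R ^ m) hgeo (fun m => ?_)
      (Eventually.of_forall fun n m => ?_)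
    · simpa using this
    · have := (((h.1 m).sub_const (phiCoeff ν m)).abs).mul_const (R ^ m)
      simpa using this
    · rw [Real.norm_of_nonneg (by positivity)]
      exact hbound n m
  rw [Metric.tendstoUniformlyOn_iff]
  intro ε hε
  filter_upwards [hlim.eventually_lt_const hε] with n hn z hz
  rw [dist_comm, dist_eq_norm]
  refine lt_of_le_of_lt ?_ hn
  have h1 := (hasSum_scaled_taylor (P n) c (κ n) (b n) (z ^ 2)).sub (hasSum_phi hν z)
  rw [← h1.tsum_eq]
  have hzR : ‖z‖ ^ 2 ≤ R := pow_le_pow_left₀ (norm_nonneg _) (hr z hz) 2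
  have hs : Summable fun m => |V n m - phiCoeff ν m| * R ^ m :=
    Summable.of_nonneg_of_le (fun m => by positivity) (hbound n) hgeo
  refine tsum_of_norm_bounded hs.hasSum fun m => ?_
  rw [← sub_mul, ← Complex.ofReal_sub, norm_mul, Complex.norm_real, Real.norm_eq_abs, norm_pow,
    norm_pow]
  exact mul_le_mul_of_nonneg_left (pow_le_pow_left₀ (by positivity) hzR m) (abs_nonneg _)

theorem exists_eq_sum_smul_of_degree_eq {P : ℕ → ℝ[X]} (hdeg : ∀ n, (P n).degree = n) (N : ℕ) :
    ∀ F : ℝ[X], F.degree < N → ∃ d : ℕ → ℝ, F = ∑ k ∈ Finset.range N, d k • P k := by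
  induction N with
  | zero =>
    intro F hF
    refine ⟨0, ?_⟩
    have : F = 0 := by
      rw [← degree_eq_bot]
      simpa using hF
    simp [this]
  | succ N ih =>
    intro F hF
    have hne : (P N).coeff N ≠ 0 := by
      have h1 : (P N).natDegree = N := natDegree_eq_of_degree_eq_some (hdeg N)
      have h2 : P N ≠ 0 := fun h => by simpa [h] using hdeg N
      have h3 := leadingCoeff_ne_zero.2 h2
      rwa [leadingCoeff, h1] at h3
    obtain ⟨d, hd⟩ := ih (F - (F.coeff N / (P N).coeff N) • P N) (by
      rw [degree_lt_iff_coeff_zero] at hF ⊢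
      intro m hm
      rcases hm.eq_or_lt with rfl | hm
      · simp [hne]
      · have h1 : (P N).coeff m = 0 := coeff_eq_zero_of_degree_lt (by
          rw [hdeg N]
          exact_mod_cast hm)
        simp [hF m hm, h1])
    refine ⟨Function.update d N (F.coeff N / (P N).coeff N), ?_⟩
    rw [Finset.sum_range_succ, Function.update_self,
      Finset.sum_congr rfl (g := fun k => d k • P k) fun k hk => ?_, ← hd, sub_add_cancel]
    rw [Function.update_of_ne (Finset.mem_range.1 hk).ne]

/-- Taylor coefficients at `c` of the kernel `∑ k ≤ n, P k c * P k x`. -/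
def kernelCoeff (P : ℕ → ℝ[X]) (c : ℝ) (n m : ℕ) : ℝ :=
  ∑ k ∈ Finset.range (n + 1), (taylor c (P k)).coeff 0 * (taylor c (P k)).coeff m

theorem kernelCoeff_succ (P : ℕ → ℝ[X]) (c : ℝ) (n m : ℕ) :
    kernelCoeff P c (n + 1) m =
      kernelCoeff P c n m + (taylor c (P (n + 1))).coeff 0 * (taylor c (P (n + 1))).coeff m :=
  Finset.sum_range_succ _ _

theorem taylor_coeff_zero_ne_zero {P : ℝ[X]} (h : P.degree = 0) (c : ℝ) :
    (taylor c P).coeff 0 ≠ 0 := by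
  rw [eq_C_of_degree_eq_zero h, taylor_C, coeff_C_zero]
  exact coeff_ne_zero_of_eq_degree h

theorem kernelCoeff_zero_pos {P : ℕ → ℝ[X]} (h : (P 0).degree = 0) (c : ℝ) (n : ℕ) :
    0 < kernelCoeff P c n 0 := by
  refine Finset.sum_pos' (fun k _ => mul_self_nonneg _) ⟨0, by simp, ?_⟩
  exact mul_self_pos.2 (taylor_coeff_zero_ne_zero h c)

/-- Orthonormal polynomials for `(x - c) ^ 2 dλ` in terms of those for `λ`, coefficientwise
at `c`. -/
theorem taylor_coeff_christoffel {L : ℝ[X] →ₗ[ℝ] ℝ} {P Q : ℕ → ℝ[X]} {c : ℝ}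
    (hPdeg : ∀ n, (P n).degree = n) (hPlc : ∀ n, 0 < (P n).leadingCoeff)
    (hP : ∀ n m, L (P n * P m) = if n = m then 1 else 0)
    (hQdeg : ∀ n, (Q n).degree = n) (hQlc : ∀ n, 0 < (Q n).leadingCoeff)
    (hQ : ∀ n m, L ((X - C c) ^ 2 * (Q n * Q m)) = if n = m then 1 else 0) (n m : ℕ) :
    (taylor c (Q n)).coeff m =
      Real.sqrt (kernelCoeff P c n 0 / kernelCoeff P c (n + 1) 0) *
        ((taylor c (P (n + 1))).coeff (m + 1) -
          (taylor c (P (n + 1))).coeff 0 *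
            (kernelCoeff P c n (m + 1) / kernelCoeff P c n 0)) := by
  set F := (X - C c) * Q n with hF
  have hFdeg : F.degree = (n + 1 : ℕ) := by
    rw [hF, degree_mul, degree_X_sub_C, hQdeg, add_comm]
    rfl
  obtain ⟨f, hf⟩ := exists_eq_sum_smul_of_degree_eq hPdeg (n + 2) F (by
    rw [hFdeg]
    exact_mod_cast Nat.lt_succ_self _)
  have hfk : ∀ k < n + 2, L (F * P k) = f k := by
    intro k hk
    rw [hf, Finset.sum_mul, map_sum]
    simp only [smul_mul_assoc, map_smul, hP, smul_eq_mul, mul_ite, mul_one, mul_zero]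
    rw [Finset.sum_ite_eq' (Finset.range (n + 2)) k f, if_pos (Finset.mem_range.2 hk)]
  have horth : ∀ h : ℝ[X], h.degree < (n + 1 : ℕ) → h.eval c = 0 → L (F * h) = 0 := by
    intro h hdeg hc
    obtain ⟨g, rfl⟩ := dvd_iff_isRoot.2 hc
    obtain ⟨d, hd⟩ := exists_eq_sum_smul_of_degree_eq hQdeg n g (by
      rcases eq_or_ne g 0 with rfl | hg
      · simp
      · rw [degree_mul, degree_X_sub_C, degree_eq_natDegree hg] at hdeg
        rw [degree_eq_natDegree hg]
        have : 1 + g.natDegree < n + 1 := by exact_mod_cast hdeg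
        exact_mod_cast (by lia : g.natDegree < n))
    have h1 : F * ((X - C c) * g) = (X - C c) ^ 2 * (Q n * g) := by rw [hF]; ring
    rw [h1, hd, Finset.mul_sum, Finset.mul_sum, map_sum]
    refine Finset.sum_eq_zero fun k hk => ?_
    rw [mul_smul_comm, mul_smul_comm, map_smul, hQ, if_neg (Finset.mem_range.1 hk).ne', smul_zero]
  set u := fun k i => (taylor c (P k)).coeff i with hu
  have hu0 : u 0 0 ≠ 0 := taylor_coeff_zero_ne_zero (by simpa using hPdeg 0) c
  set τ := f 0 / u 0 0 with hτ
  have hfτ : ∀ k < n + 1, f k = τ * u k 0 := by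
    intro k hk
    have h1 := horth (u 0 0 • P k - u k 0 • P 0) (by
        refine lt_of_le_of_lt (degree_sub_le _ _) (max_lt ?_ ?_)
        · refine lt_of_le_of_lt (degree_smul_le _ _) ?_
          rw [hPdeg]
          exact_mod_cast hk
        · refine lt_of_le_of_lt (degree_smul_le _ _) ?_
          rw [hPdeg]
          exact_mod_cast Nat.succ_pos n) (by
        simp only [hu, taylor_coeff_zero, eval_sub, eval_smul, smul_eq_mul]
        ring)
    rw [mul_sub, mul_smul_comm, mul_smul_comm, map_sub, map_smul, map_smul, hfk k (by lia),
      hfk 0 (by lia), smul_eq_mul, smul_eq_mul] at h1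
    rw [hτ]
    field_simp
    linarith
  have hnorm : ∑ k ∈ Finset.range (n + 2), f k * f k = 1 := by
    have h1 : L (F * F) = 1 := by
      have h2 : F * F = (X - C c) ^ 2 * (Q n * Q n) := by rw [hF]; ring
      rw [h2, hQ, if_pos rfl]
    rw [← h1]
    conv_rhs => rw [show F * F = F * ∑ k ∈ Finset.range (n + 2), f k • P k by rw [← hf]]
    rw [Finset.mul_sum, map_sum]
    refine Finset.sum_congr rfl fun k hk => ?_
    rw [mul_smul_comm, map_smul, hfk k (Finset.mem_range.1 hk), smul_eq_mul]
  have htaylor : ∀ i, (taylor c F).coeff i = ∑ k ∈ Finset.range (n + 2), f k * u k i := by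
    intro i
    conv_lhs => rw [hf]
    simp [hu]
  have hF_taylor : taylor c F = X * taylor c (Q n) := by
    rw [hF, taylor_mul]
    simp
  have hsum : ∀ i, ∑ k ∈ Finset.range (n + 2), f k * u k i =
      τ * kernelCoeff P c n i + f (n + 1) * u (n + 1) i := by
    intro i
    rw [Finset.sum_range_succ, kernelCoeff, Finset.mul_sum]
    congr 1
    refine Finset.sum_congr rfl fun k hk => ?_
    rw [hfτ k (Finset.mem_range.1 hk)]
    ring
  have h0 : τ * kernelCoeff P c n 0 + f (n + 1) * u (n + 1) 0 = 0 := by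
    rw [← hsum, ← htaylor, hF_taylor, coeff_X_mul_zero]
  have hm : (taylor c (Q n)).coeff m =
      τ * kernelCoeff P c n (m + 1) + f (n + 1) * u (n + 1) (m + 1) := by
    rw [← hsum, ← htaylor, hF_taylor, coeff_X_mul]
  have h1 : τ ^ 2 * kernelCoeff P c n 0 + f (n + 1) ^ 2 = 1 := by
    rw [← hnorm, Finset.sum_range_succ, kernelCoeff, Finset.mul_sum, sq (f (n + 1))]
    congr 1
    refine Finset.sum_congr rfl fun k hk => ?_
    rw [hfτ k (Finset.mem_range.1 hk)]
    ring
  have hpos : 0 < f (n + 1) := by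
    have h2 : F.leadingCoeff = (Q n).leadingCoeff := by
      rw [hF, leadingCoeff_mul, leadingCoeff_X_sub_C, one_mul]
    have h3 : F.leadingCoeff = f (n + 1) * (P (n + 1)).leadingCoeff := by
      rw [leadingCoeff, leadingCoeff, natDegree_eq_of_degree_eq_some hFdeg,
        natDegree_eq_of_degree_eq_some (hPdeg (n + 1))]
      conv_lhs => rw [hf]
      rw [finsetSum_coeff, Finset.sum_range_succ, Finset.sum_eq_zero fun k hk => ?_]
      · simp
      · rw [coeff_smul, coeff_eq_zero_of_degree_lt, smul_zero]
        rw [hPdeg]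
        exact_mod_cast Finset.mem_range.1 hk
    have h4 := hQlc n
    rw [← h2, h3] at h4
    exact pos_of_mul_pos_left h4 (hPlc _).le
  have hK : 0 < kernelCoeff P c n 0 := kernelCoeff_zero_pos (by simpa using hPdeg 0) c n
  have hK' : kernelCoeff P c (n + 1) 0 = kernelCoeff P c n 0 + u (n + 1) 0 ^ 2 := by
    rw [kernelCoeff_succ, sq]
  have hτ' : τ = -(f (n + 1) * u (n + 1) 0) / kernelCoeff P c n 0 := by
    field_simp
    linarith
  have hsqrt : Real.sqrt (kernelCoeff P c n 0 / kernelCoeff P c (n + 1) 0) = f (n + 1) := by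
    rw [Real.sqrt_eq_iff_mul_self_eq_of_pos hpos, hK', eq_div_iff (by positivity)]
    rw [hτ'] at h1
    field_simp at h1
    linarith
  rw [hsqrt, hm, hτ']
  field_simp
  ring

/-- Integration against `muMod μ c j` as a linear functional on polynomials. -/
def muFunctional (μ : Measure ℝ) (c : ℝ)
    (j : ℕ) (hj : ∀ p : ℝ[X], Integrable (fun x => p.eval x) (muMod μ c j)) : ℝ[X] →ₗ[ℝ] ℝ where
  toFun p := ∫ x, p.eval x ∂(muMod μ c j)
  map_add' p q := by
    simp only [eval_add]
    exact integral_add (hj p) (hj q)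
  map_smul' r p := by
    simp only [eval_smul, smul_eq_mul, RingHom.id_apply]
    exact integral_const_mul r _

theorem measurable_muMod_density (c : ℝ) (j : ℕ) :
    Measurable fun x : ℝ => ENNReal.ofReal ((x - c) ^ j) := by
  fun_prop

theorem integrable_eval_muMod {μ : Measure ℝ}
    (hint : ∀ p : ℝ[X], Integrable (fun x => p.eval x) μ) (c : ℝ) (j : ℕ) (p : ℝ[X]) :
    Integrable (fun x => p.eval x) (muMod μ c j) := by
  rw [muMod, integrable_withDensity_iff_integrable_smul' (measurable_muMod_density c j)
    (Eventually.of_forall fun _ => ENNReal.ofReal_lt_top)]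
  refine (hint ((X - C c) ^ j * p)).mono
    (((measurable_muMod_density c j).ennreal_toReal.smul p.continuous.measurable).aestronglyMeasurable)
    (Eventually.of_forall fun x => ?_)
  rw [ENNReal.toReal_ofReal', norm_smul, eval_mul, norm_mul]
  refine mul_le_mul_of_nonneg_right ?_ (norm_nonneg _)
  simp only [eval_pow, eval_sub, eval_X, eval_C, Real.norm_eq_abs]
  rw [abs_of_nonneg (le_max_right _ _)]
  exact max_le (le_abs_self _) (abs_nonneg _)

theorem integral_muMod_add_two (μ : Measure ℝ) (c : ℝ) (j : ℕ) (g : ℝ → ℝ) :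
    ∫ x, g x ∂(muMod μ c (j + 2)) = ∫ x, (x - c) ^ 2 * g x ∂(muMod μ c j) := by
  rw [muMod, muMod, integral_withDensity_eq_integral_toReal_smul (measurable_muMod_density c _)
    (Eventually.of_forall fun _ => ENNReal.ofReal_lt_top),
    integral_withDensity_eq_integral_toReal_smul (measurable_muMod_density c _)
    (Eventually.of_forall fun _ => ENNReal.ofReal_lt_top)]
  congr 1
  ext x
  rw [ENNReal.toReal_ofReal', ENNReal.toReal_ofReal', smul_eq_mul, smul_eq_mul, pow_add,
    show max ((x - c) ^ j * (x - c) ^ 2) 0 = max ((x - c) ^ j) 0 * (x - c) ^ 2 by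
      rw [max_mul_of_nonneg _ _ (sq_nonneg _), zero_mul]]
  ring

theorem taylor_coeff_add_two {μ : Measure ℝ}
    (hint : ∀ p : ℝ[X], Integrable (fun x => p.eval x) μ) {c : ℝ} {j : ℕ} {P Q : ℕ → ℝ[X]}
    (hP : IsOPS (muMod μ c j) P) (hQ : IsOPS (muMod μ c (j + 2)) Q) (n m : ℕ) :
    (taylor c (Q n)).coeff m =
      Real.sqrt (kernelCoeff P c n 0 / kernelCoeff P c (n + 1) 0) *
        ((taylor c (P (n + 1))).coeff (m + 1) -
          (taylor c (P (n + 1))).coeff 0 *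
            (kernelCoeff P c n (m + 1) / kernelCoeff P c n 0)) := by
  refine taylor_coeff_christoffel (L := muFunctional μ c j (integrable_eval_muMod hint c j))
    hP.1 hP.2.1 (fun n m => ?_) hQ.1 hQ.2.1 (fun n m => ?_) n m
  · rw [← hP.2.2 n m]
    simp [muFunctional]
  · rw [← hQ.2.2 n m, integral_muMod_add_two]
    simp [muFunctional]

theorem tendsto_rpow_succ_sub_div {r : ℝ} :
    Tendsto (fun k : ℕ => (((k : ℝ) + 1) ^ r - (k : ℝ) ^ r) / (k : ℝ) ^ (r - 1)) atTop (𝓝 r) := by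
  have hd : HasDerivAt (fun x : ℝ => x ^ r) r 1 := by
    simpa using Real.hasDerivAt_rpow_const (x := 1) (p := r) (Or.inl one_ne_zero)
  have h1 := hd.tendsto_slope_zero
  have h2 : Tendsto (fun k : ℕ => ((k : ℝ))⁻¹) atTop (𝓝[≠] 0) := by
    rw [tendsto_nhdsWithin_iff]
    refine ⟨tendsto_inv_atTop_nhds_zero_nat, ?_⟩
    filter_upwards [eventually_gt_atTop 0] with k hk
    have : (0 : ℝ) < k := by exact_mod_cast hk
    simp [hk.ne']
  refine (h1.comp h2).congr' ?_
  filter_upwards [eventually_gt_atTop 0] with k hk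
  have hk' : (0 : ℝ) < k := by exact_mod_cast hk
  have h3 : (1 : ℝ) + (k : ℝ)⁻¹ = (k + 1) / k := by field_simp
  simp only [Function.comp_apply, inv_inv, Real.one_rpow, smul_eq_mul]
  rw [h3, Real.div_rpow (by positivity) hk'.le, Real.rpow_sub_one hk'.ne']
  have := Real.rpow_pos_of_pos hk' r
  field_simp

/-- A Cesàro-type lemma with power weights. -/
theorem tendsto_sum_range_div_rpow {f : ℕ → ℝ} {r l : ℝ} (hr : 0 < r)
    (hf : Tendsto (fun k : ℕ => f k / (k : ℝ) ^ (r - 1)) atTop (𝓝 l)) :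
    Tendsto (fun n : ℕ => (∑ k ∈ Finset.range n, f k) / (n : ℝ) ^ r) atTop (𝓝 (l / r)) := by
  set g : ℕ → ℝ := fun k => ((k : ℝ) + 1) ^ r - (k : ℝ) ^ r with hg
  have hgpos : ∀ k, 0 < g k := fun k =>
    sub_pos.2 (Real.rpow_lt_rpow k.cast_nonneg (by linarith) hr)
  have hgsum : ∀ n, ∑ k ∈ Finset.range n, g k = (n : ℝ) ^ r := by
    intro n
    have := Finset.sum_range_sub (fun k : ℕ => (k : ℝ) ^ r) n
    push_cast at this
    rw [hg, this, Real.zero_rpow hr.ne', sub_zero]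
  have hfg : Tendsto (fun k => f k / g k) atTop (𝓝 (l / r)) := by
    refine (hf.div tendsto_rpow_succ_sub_div hr.ne').congr' ?_
    filter_upwards [eventually_gt_atTop 0] with k hk
    have hk' : (0 : ℝ) < k := by exact_mod_cast hk
    have := Real.rpow_pos_of_pos hk' (r - 1)
    exact div_div_div_cancel_right₀ this.ne' _ _
  have ho : (fun k => f k - l / r * g k) =o[atTop] g := by
    rw [Asymptotics.isLittleO_iff_tendsto' (Eventually.of_forall fun k h =>
      absurd h (hgpos k).ne')]
    have := hfg.sub_const (l / r)
    rw [sub_self] at this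
    refine this.congr fun k => ?_
    have := (hgpos k).ne'
    field_simp
  have hatTop : Tendsto (fun n : ℕ => (n : ℝ) ^ r) atTop atTop :=
    (tendsto_rpow_atTop hr).comp tendsto_natCast_atTop_atTop
  have hsum := ho.sum_range (fun k => (hgpos k).le) (by simpa only [hgsum] using hatTop)
  simp only [Finset.sum_sub_distrib, ← Finset.mul_sum, hgsum] at hsum
  have := hsum.tendsto_div_nhds_zero.add_const (l / r)
  rw [zero_add] at this
  refine this.congr' ?_
  filter_upwards [eventually_gt_atTop 0] with n hn
  have hn' : (0 : ℝ) < n := by exact_mod_cast hn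
  have := Real.rpow_pos_of_pos hn' r
  field_simp
  ring

theorem tendsto_succ_div_of_tendsto_div_rpow {x : ℕ → ℝ} {p X : ℝ} (hX : X ≠ 0)
    (hx : Tendsto (fun n : ℕ => x n / (n : ℝ) ^ p) atTop (𝓝 X)) :
    Tendsto (fun n => x (n + 1) / x n) atTop (𝓝 1) := by
  have h1 := (hx.comp (tendsto_add_atTop_nat 1)).div hx hX
  have h2 : Tendsto (fun n : ℕ => (((n : ℝ) + 1) / n) ^ p) atTop (𝓝 1) := by
    have h3 : Tendsto (fun n : ℕ => ((n : ℝ) + 1) / n) atTop (𝓝 1) := by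
      have := (tendsto_inv_atTop_nhds_zero_nat (𝕜 := ℝ)).const_add 1
      rw [add_zero] at this
      refine this.congr' ?_
      filter_upwards [eventually_gt_atTop 0] with n hn
      have hn' : (0 : ℝ) < n := by exact_mod_cast hn
      field_simp
    simpa using h3.rpow_const (p := p) (Or.inl one_ne_zero)
  have h4 := h1.mul h2
  rw [div_self hX, one_mul] at h4
  refine h4.congr' ?_
  filter_upwards [eventually_gt_atTop 0] with n hn
  have hn' : (0 : ℝ) < n := by exact_mod_cast hn
  have h5 := Real.rpow_pos_of_pos hn' p
  have h6 := Real.rpow_pos_of_pos (by linarith : (0 : ℝ) < n + 1) p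
  simp only [Function.comp_apply, Nat.cast_add, Nat.cast_one, Pi.div_apply]
  rw [Real.div_rpow (by positivity) hn'.le]
  field_simp

theorem exists_forall_le_of_tendsto {x : ℕ → ℝ} {l : ℝ} (h : Tendsto x atTop (𝓝 l)) :
    ∃ D, 0 < D ∧ ∀ n, x n ≤ D := by
  obtain ⟨D, hD⟩ := h.bddAbove_range
  exact ⟨max D 1, by positivity, fun n => (hD ⟨n, rfl⟩).trans (le_max_left _ _)⟩

theorem exists_div_succ_le {b : ℕ → ℝ} {B β : ℝ} (hb : ∀ n, 0 < b n) (hB : 0 < B) (hβ : 0 < β)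
    (hbB : Tendsto (fun n : ℕ => b n / (n : ℝ) ^ β) atTop (𝓝 B)) :
    ∃ D, 0 < D ∧ ∀ n, ∀ k ≤ n, b k / b (n + 1) ≤ D := by
  have h1 : Tendsto (fun n : ℕ => b (n + 1) / ((n : ℝ) + 1) ^ β) atTop (𝓝 B) := by
    have := hbB.comp (tendsto_add_atTop_nat 1)
    refine this.congr fun n => ?_
    simp
  obtain ⟨D, hD, hD'⟩ := exists_forall_le_of_tendsto h1
  obtain ⟨E, hE, hE'⟩ := exists_forall_le_of_tendsto (h1.inv₀ hB.ne')
  refine ⟨(D + b 0) * E, by have := hb 0; positivity, fun n k hk => ?_⟩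
  have hpn : (1 : ℝ) ≤ ((n : ℝ) + 1) ^ β := Real.one_le_rpow (by simp) hβ.le
  have hbk : b k ≤ (D + b 0) * ((n : ℝ) + 1) ^ β := by
    rcases k with _ | k
    · have := hb 0
      nlinarith
    · have h2 := hD' k
      have hpk : (0 : ℝ) < ((k : ℝ) + 1) ^ β := by positivity
      rw [div_le_iff₀ hpk] at h2
      have h3 : ((k : ℝ) + 1) ^ β ≤ ((n : ℝ) + 1) ^ β :=
        Real.rpow_le_rpow (by positivity) (by exact_mod_cast (by lia : k + 1 ≤ n + 1)) hβ.le
      have := hb 0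
      nlinarith
  have h4 := hE' n
  rw [inv_div, div_le_iff₀ (hb _)] at h4
  rw [div_le_iff₀ (hb _), mul_assoc]
  refine hbk.trans (mul_le_mul_of_nonneg_left h4 ?_)
  have := hb 0
  positivity

/-- The Christoffel relation in terms of rescaled coefficients. -/
theorem scaled_christoffel {σ α α' b b' ρ u u₀ K K₀ : ℝ} (hα' : α' ≠ 0) (hb : b ≠ 0)
    (hb' : b' ≠ 0) (m : ℕ) :
    σ * (α / b) * (ρ * (u - u₀ * (K / K₀))) / b ^ m =
      -(ρ * (α / α') * (b' / b) ^ (m + 1) *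
        (σ * -1 * α' * u / b' ^ (m + 1) - σ * -1 * α' * u₀ / b' ^ 0 *
          (K / K₀ / b' ^ (m + 1)))) := by
  rw [div_pow, pow_zero, div_one, pow_succ b m]
  have := pow_ne_zero (m + 1) hb'
  have := pow_ne_zero m hb
  field_simp
  ring

section Step

variable {P : ℕ → ℝ[X]} {c : ℝ} {α b : ℕ → ℝ} {A B e β ν : ℝ}

theorem taylor_mul_taylor_eq (hα : ∀ n, 0 < α n) (hb : ∀ n, 0 < b n) (k m : ℕ) :
    (taylor c (P k)).coeff 0 * (taylor c (P k)).coeff m =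
      ((α k)⁻¹) ^ 2 * ((-1) ^ k * α k * (taylor c (P k)).coeff 0 / b k ^ 0) *
        ((-1) ^ k * α k * (taylor c (P k)).coeff m / b k ^ m) * b k ^ m := by
  have h1 := (hα k).ne'
  have h2 := pow_ne_zero m (hb k).ne'
  have h3 : ((-1 : ℝ) ^ k) * (-1) ^ k = 1 := by rw [← mul_pow]; simp
  have h4 : ((α k)⁻¹) ^ 2 * ((-1) ^ k * α k * (taylor c (P k)).coeff 0 / b k ^ 0) *
        ((-1) ^ k * α k * (taylor c (P k)).coeff m / b k ^ m) * b k ^ m =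
      ((-1 : ℝ) ^ k * (-1) ^ k) * ((taylor c (P k)).coeff 0 * (taylor c (P k)).coeff m) := by
    field_simp
  rw [h4, h3, one_mul]

theorem tendsto_kernelCoeff (hα : ∀ n, 0 < α n) (hb : ∀ n, 0 < b n) {φ : ℕ → ℝ}
    (hr : 0 < 2 * e + 1) (hβ : 0 < β)
    (hαA : Tendsto (fun n : ℕ => (α n)⁻¹ / (n : ℝ) ^ e) atTop (𝓝 A))
    (hbB : Tendsto (fun n : ℕ => b n / (n : ℝ) ^ β) atTop (𝓝 B))
    (hV : ∀ m, Tendsto (fun n => (-1) ^ n * α n * (taylor c (P n)).coeff m / b n ^ m) atTop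
      (𝓝 (φ m))) (m : ℕ) :
    Tendsto (fun n : ℕ => kernelCoeff P c n m / ((n : ℝ) + 1) ^ (2 * e + 1 + β * m)) atTop
      (𝓝 (A ^ 2 * φ 0 * φ m * B ^ m / (2 * e + 1 + β * m))) := by
  have h1 : Tendsto (fun k : ℕ => ((taylor c (P k)).coeff 0 * (taylor c (P k)).coeff m) /
      (k : ℝ) ^ ((2 * e + 1 + β * m) - 1)) atTop (𝓝 (A ^ 2 * φ 0 * φ m * B ^ m)) := by
    refine ((((hαA.pow 2).mul (hV 0)).mul (hV m)).mul (hbB.pow m)).congr' ?_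
    filter_upwards [eventually_gt_atTop 0] with k hk
    have hk' : (0 : ℝ) < k := by exact_mod_cast hk
    rw [taylor_mul_taylor_eq hα hb k m, show 2 * e + 1 + β * m - 1 = e * (2 : ℕ) + β * m by
      push_cast; ring, Real.rpow_add hk', Real.rpow_mul_natCast hk'.le,
      Real.rpow_mul_natCast hk'.le]
    have h5 := Real.rpow_pos_of_pos hk' e
    have h6 := Real.rpow_pos_of_pos hk' β
    rw [div_pow, div_pow]
    field_simp
  have h2 := (tendsto_sum_range_div_rpow (by positivity) h1).comp (tendsto_add_atTop_nat 1)
  refine h2.congr fun n => ?_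
  simp [kernelCoeff]

theorem exists_sum_inv_sq_le (hα : ∀ n, 0 < α n) (hb : ∀ n, 0 < b n) {φ : ℕ → ℝ}
    (hφ : φ 0 ≠ 0) (hA : A ≠ 0)
    (hr : 0 < 2 * e + 1) (hβ : 0 < β)
    (hαA : Tendsto (fun n : ℕ => (α n)⁻¹ / (n : ℝ) ^ e) atTop (𝓝 A))
    (hbB : Tendsto (fun n : ℕ => b n / (n : ℝ) ^ β) atTop (𝓝 B))
    (hV : ∀ m, Tendsto (fun n => (-1) ^ n * α n * (taylor c (P n)).coeff m / b n ^ m) atTop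
      (𝓝 (φ m))) :
    ∃ D, 0 < D ∧ ∀ n,
      (∑ k ∈ Finset.range (n + 1), ((α k)⁻¹) ^ 2) / kernelCoeff P c n 0 ≤ D := by
  have h1 : Tendsto (fun k : ℕ => ((α k)⁻¹) ^ 2 / (k : ℝ) ^ ((2 * e + 1) - 1)) atTop
      (𝓝 (A ^ 2)) := by
    refine (hαA.pow 2).congr' ?_
    filter_upwards [eventually_gt_atTop 0] with k hk
    have hk' : (0 : ℝ) < k := by exact_mod_cast hk
    rw [show 2 * e + 1 - 1 = e * (2 : ℕ) by push_cast; ring, Real.rpow_mul_natCast hk'.le, div_pow]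
  have h2 := (tendsto_sum_range_div_rpow hr h1).comp (tendsto_add_atTop_nat 1)
  have h3 := tendsto_kernelCoeff hα hb hr hβ hαA hbB hV 0
  have h4 := h2.div h3 (by
    simp only [Nat.cast_zero, mul_zero, add_zero, pow_zero, mul_one]
    positivity)
  refine exists_forall_le_of_tendsto (h4.congr fun n => ?_)
  have h5 : ((n : ℝ) + 1) ^ (2 * e + 1) ≠ 0 := by positivity
  simp only [Function.comp_apply, Pi.div_apply, Nat.cast_add, Nat.cast_one, Nat.cast_zero,
    mul_zero, add_zero]
  exact div_div_div_cancel_right₀ h5 _ _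

theorem exists_kernelCoeff_ratio_le (hα : ∀ n, 0 < α n) (hb : ∀ n, 0 < b n) {φ : ℕ → ℝ}
    (hP0 : (P 0).degree = 0) (hφ : φ 0 ≠ 0) (hA : A ≠ 0) (hB : 0 < B)
    (hr : 0 < 2 * e + 1) (hβ : 0 < β)
    (hαA : Tendsto (fun n : ℕ => (α n)⁻¹ / (n : ℝ) ^ e) atTop (𝓝 A))
    (hbB : Tendsto (fun n : ℕ => b n / (n : ℝ) ^ β) atTop (𝓝 B))
    (hV : CoeffTendsto (fun n m => (-1) ^ n * α n * (taylor c (P n)).coeff m / b n ^ m) φ)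
    {R : ℝ} (hR : 0 ≤ R) :
    ∃ C, ∀ n m, |kernelCoeff P c n m / kernelCoeff P c n 0 / b (n + 1) ^ m| * R ^ m ≤ C := by
  obtain ⟨D, hD, hbD⟩ := exists_div_succ_le hb hB hβ hbB
  obtain ⟨E, hE, hαE⟩ := exists_sum_inv_sq_le hα hb hφ hA hr hβ hαA hbB hV.1
  obtain ⟨C, hC⟩ := hV.2 (D * R) (by positivity)
  obtain ⟨C₀, hC₀⟩ := hV.2 0 le_rfl
  set V : ℕ → ℕ → ℝ := fun n m => (-1) ^ n * α n * (taylor c (P n)).coeff m / b n ^ m with hVdef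
  have hV0 : ∀ n, |V n 0| ≤ C₀ := fun n => by simpa using hC₀ n 0
  have hC₀' : 0 ≤ C₀ := (abs_nonneg _).trans (hV0 0)
  have hC' : 0 ≤ C := le_trans (by positivity) (hC 0 0)
  refine ⟨C₀ * C * E, fun n m => ?_⟩
  have hK := kernelCoeff_zero_pos hP0 c n
  have hbn := hb (n + 1)
  have hterm : ∀ k ∈ Finset.range (n + 1),
      |(taylor c (P k)).coeff 0 * (taylor c (P k)).coeff m| ≤
        ((α k)⁻¹) ^ 2 * C₀ * (|V k m| * b k ^ m) := by
    intro k _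
    have hbk := pow_pos (hb k) m
    have h1 : (taylor c (P k)).coeff 0 * (taylor c (P k)).coeff m =
        ((α k)⁻¹) ^ 2 * V k 0 * V k m * b k ^ m := taylor_mul_taylor_eq hα hb k m
    rw [h1, abs_mul, abs_mul, abs_mul, abs_of_pos hbk, abs_of_nonneg (sq_nonneg (α k)⁻¹), mul_assoc]
    gcongr
    exact hV0 k
  have hterm' : ∀ k ∈ Finset.range (n + 1),
      (|V k m| * b k ^ m) * (R ^ m / b (n + 1) ^ m) ≤ C := by
    intro k hk
    refine le_trans ?_ (hC k m)
    rw [mul_assoc]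
    refine mul_le_mul_of_nonneg_left ?_ (abs_nonneg _)
    rw [show b k ^ m * (R ^ m / b (n + 1) ^ m) = (b k / b (n + 1)) ^ m * R ^ m by
      rw [div_pow]; ring, mul_pow]
    refine mul_le_mul_of_nonneg_right ?_ (pow_nonneg hR m)
    exact pow_le_pow_left₀ (div_pos (hb k) hbn).le
      (hbD n k (by have := Finset.mem_range.1 hk; lia)) m
  have hsum : |kernelCoeff P c n m| * (R ^ m / b (n + 1) ^ m) ≤
      C₀ * C * ∑ k ∈ Finset.range (n + 1), ((α k)⁻¹) ^ 2 := by
    have hnn : 0 ≤ R ^ m / b (n + 1) ^ m := by positivity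
    refine (mul_le_mul_of_nonneg_right (Finset.abs_sum_le_sum_abs _ _) hnn).trans ?_
    rw [Finset.sum_mul, Finset.mul_sum]
    refine Finset.sum_le_sum fun k hk => ?_
    refine (mul_le_mul_of_nonneg_right (hterm k hk) hnn).trans ?_
    rw [mul_assoc]
    refine (mul_le_mul_of_nonneg_left (hterm' k hk) (by positivity)).trans_eq ?_
    ring
  rw [abs_div, abs_div, abs_of_pos hK, abs_of_pos (pow_pos hbn m),
    show |kernelCoeff P c n m| / kernelCoeff P c n 0 / b (n + 1) ^ m * R ^ m =
      |kernelCoeff P c n m| * (R ^ m / b (n + 1) ^ m) / kernelCoeff P c n 0 by ring]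
  refine (div_le_div_of_nonneg_right hsum hK.le).trans ?_
  rw [mul_div_assoc]
  exact mul_le_mul_of_nonneg_left (hαE n) (by positivity)

theorem tendsto_kernelCoeff_ratio (hα : ∀ n, 0 < α n) (hb : ∀ n, 0 < b n) {φ : ℕ → ℝ}
    (hφ : φ 0 ≠ 0) (hA : A ≠ 0) (hB : 0 < B)
    (hr : 0 < 2 * e + 1) (hβ : 0 < β)
    (hαA : Tendsto (fun n : ℕ => (α n)⁻¹ / (n : ℝ) ^ e) atTop (𝓝 A))
    (hbB : Tendsto (fun n : ℕ => b n / (n : ℝ) ^ β) atTop (𝓝 B))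
    (hV : ∀ m, Tendsto (fun n => (-1) ^ n * α n * (taylor c (P n)).coeff m / b n ^ m) atTop
      (𝓝 (φ m))) (m : ℕ) :
    Tendsto (fun n => kernelCoeff P c n m / kernelCoeff P c n 0 / b (n + 1) ^ m) atTop
      (𝓝 (φ m / φ 0 * ((2 * e + 1) / (2 * e + 1 + β * m)))) := by
  have hm := tendsto_kernelCoeff hα hb hr hβ hαA hbB hV m
  have h0 := tendsto_kernelCoeff hα hb hr hβ hαA hbB hV 0
  have hbm := ((hbB.comp (tendsto_add_atTop_nat 1)).pow m)
  have hr' : 0 < 2 * e + 1 + β * m := by positivity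
  have h1 := (hm.div h0 (by
    simp only [Nat.cast_zero, mul_zero, add_zero, pow_zero, mul_one]
    positivity)).div hbm (by positivity)
  have h2 : A ^ 2 * φ 0 * φ m * B ^ m / (2 * e + 1 + β * m) /
      (A ^ 2 * φ 0 * φ 0 * B ^ 0 / (2 * e + 1 + β * (0 : ℕ))) / B ^ m =
      φ m / φ 0 * ((2 * e + 1) / (2 * e + 1 + β * m)) := by
    simp only [Nat.cast_zero, mul_zero, add_zero, pow_zero, mul_one]
    field_simp
  rw [h2] at h1
  refine h1.congr fun n => ?_
  have hn : (0 : ℝ) < (n : ℝ) + 1 := by positivity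
  simp only [Function.comp_apply, Pi.div_apply, Nat.cast_add, Nat.cast_one, Nat.cast_zero,
    mul_zero, add_zero]
  rw [Real.rpow_add hn, Real.rpow_mul_natCast hn.le, div_pow]
  have h5 := Real.rpow_pos_of_pos hn β
  have h6 := Real.rpow_pos_of_pos hn (2 * e + 1)
  field_simp

/-- Passing from a measure to its product with `(x - c) ^ 2` raises the order of the limiting
Bessel function by two. -/
theorem CoeffTendsto.add_two {Q : ℕ → ℝ[X]} (hα : ∀ n, 0 < α n) (hb : ∀ n, 0 < b n)
    (hP0 : (P 0).degree = 0) (hA : A ≠ 0) (hB : 0 < B) (hβ : 0 < β) (hν : -1 < ν)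
    (hlink : 2 * e + 1 = β * (ν + 1))
    (hαA : Tendsto (fun n : ℕ => (α n)⁻¹ / (n : ℝ) ^ e) atTop (𝓝 A))
    (hbB : Tendsto (fun n : ℕ => b n / (n : ℝ) ^ β) atTop (𝓝 B))
    (hV : CoeffTendsto (fun n m => (-1) ^ n * α n * (taylor c (P n)).coeff m / b n ^ m)
      (phiCoeff ν))
    (hQ : ∀ n m, (taylor c (Q n)).coeff m =
      Real.sqrt (kernelCoeff P c n 0 / kernelCoeff P c (n + 1) 0) *
        ((taylor c (P (n + 1))).coeff (m + 1) -
          (taylor c (P (n + 1))).coeff 0 *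
            (kernelCoeff P c n (m + 1) / kernelCoeff P c n 0))) :
    CoeffTendsto (fun n m => (-1) ^ n * (α n / b n) * (taylor c (Q n)).coeff m / b n ^ m)
      (phiCoeff (ν + 2)) := by
  have hr : 0 < 2 * e + 1 := by
    rw [hlink]
    exact mul_pos hβ (by linarith)
  have hφ : phiCoeff ν 0 ≠ 0 := by
    have := Real.Gamma_pos_of_pos (by linarith : 0 < ν + 1)
    simp [phiCoeff, this.ne']
  set V : ℕ → ℕ → ℝ := fun n m => (-1) ^ n * α n * (taylor c (P n)).coeff m / b n ^ m with hVdef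
  set H : ℕ → ℕ → ℝ := fun n m =>
    kernelCoeff P c n m / kernelCoeff P c n 0 / b (n + 1) ^ m with hH
  set ρ : ℕ → ℝ := fun n => Real.sqrt (kernelCoeff P c n 0 / kernelCoeff P c (n + 1) 0) *
    (α n / α (n + 1)) with hρ
  have hb1 := tendsto_succ_div_of_tendsto_div_rpow hB.ne' hbB
  have hρ1 : Tendsto ρ atTop (𝓝 1) := by
    have h1 := tendsto_succ_div_of_tendsto_div_rpow hA hαA
    have h0 := tendsto_kernelCoeff hα hb hr hβ hαA hbB hV.1 0
    have h2 := tendsto_succ_div_of_tendsto_div_rpow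
      (x := fun n => kernelCoeff P c (n - 1) 0) (p := 2 * e + 1)
      (X := A ^ 2 * phiCoeff ν 0 * phiCoeff ν 0 * B ^ 0 / (2 * e + 1 + β * (0 : ℕ)))
      (by
        simp only [Nat.cast_zero, mul_zero, add_zero, pow_zero, mul_one]
        positivity)
      (by
        rw [← tendsto_add_atTop_iff_nat 1]
        simpa using h0)
    have h3 := ((h2.comp (tendsto_add_atTop_nat 1)).inv₀ one_ne_zero).sqrt.mul h1
    rw [inv_one, Real.sqrt_one, one_mul] at h3
    refine h3.congr fun n => ?_
    have := hα n
    have := hα (n + 1)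
    simp [hρ, div_eq_mul_inv, mul_comm]
  have hid : ∀ n m, (-1) ^ n * (α n / b n) * (taylor c (Q n)).coeff m / b n ^ m =
      -(ρ n * (b (n + 1) / b n) ^ (m + 1) *
        (V (n + 1) (m + 1) - V (n + 1) 0 * H n (m + 1))) := by
    intro n m
    rw [hQ, scaled_christoffel (hα (n + 1)).ne' (hb n).ne' (hb (n + 1)).ne', ← pow_succ]
  simp only [hid, CoeffTendsto]
  refine ⟨fun m => ?_, fun R hR => ?_⟩
  · have hHlim := tendsto_kernelCoeff_ratio hα hb hφ hA hB hr hβ hαA hbB hV.1 (m + 1)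
    have h1 := ((hρ1.mul (hb1.pow (m + 1))).mul
      (((hV.1 (m + 1)).comp (tendsto_add_atTop_nat 1)).sub
        (((hV.1 0).comp (tendsto_add_atTop_nat 1)).mul hHlim))).neg
    convert! h1 using 2
    rw [phiCoeff_step hν, hlink]
    have h2 : 0 < ν + 1 := by linarith
    have h3 : (0 : ℝ) < m + ν + 2 := by
      have : (0 : ℝ) ≤ m := m.cast_nonneg
      linarith
    have h4 : β * (ν + 1) + β * ((m + 1 : ℕ) : ℝ) = β * (m + ν + 2) := by push_cast; ring
    rw [h4]
    field_simp
    ring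
  · obtain ⟨D, hD, hρD⟩ := exists_forall_le_of_tendsto hρ1
    obtain ⟨E, hE, hbE⟩ := exists_forall_le_of_tendsto hb1
    have hR' : 0 ≤ E * (R + 1) := by positivity
    obtain ⟨C, hC⟩ := hV.2 _ hR'
    obtain ⟨C₀, hC₀⟩ := hV.2 0 le_rfl
    obtain ⟨C₁, hC₁⟩ := exists_kernelCoeff_ratio_le hα hb hP0 hφ hA hB hr hβ hαA hbB hV hR'
    have hV0 : ∀ n, |V n 0| ≤ C₀ := fun n => by simpa using hC₀ n 0
    refine ⟨D * (C + C₀ * C₁), fun n m => ?_⟩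
    have hρ0 : 0 ≤ ρ n := mul_nonneg (Real.sqrt_nonneg _) (div_pos (hα _) (hα _)).le
    have hb0 : 0 ≤ b (n + 1) / b n := (div_pos (hb _) (hb _)).le
    have hpow : (b (n + 1) / b n) ^ (m + 1) * R ^ m ≤ (E * (R + 1)) ^ (m + 1) := by
      rw [mul_pow]
      refine mul_le_mul (pow_le_pow_left₀ hb0 (hbE n) _) ?_ (by positivity) (by positivity)
      refine (pow_le_pow_left₀ hR (by linarith : R ≤ R + 1) m).trans ?_
      exact pow_le_pow_right₀ (by linarith) (Nat.le_succ m)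
    have hdiff : |V (n + 1) (m + 1) - V (n + 1) 0 * H n (m + 1)| * (E * (R + 1)) ^ (m + 1) ≤
        C + C₀ * C₁ := by
      refine (mul_le_mul_of_nonneg_right (abs_sub _ _) (by positivity)).trans ?_
      rw [add_mul, abs_mul, mul_assoc]
      refine add_le_add (hC _ _) ?_
      exact mul_le_mul (hV0 _) (hC₁ n (m + 1)) (by positivity) ((abs_nonneg _).trans (hV0 0))
    rw [abs_neg, abs_mul, abs_mul, abs_of_nonneg hρ0, abs_of_nonneg (pow_nonneg hb0 _)]
    calc ρ n * (b (n + 1) / b n) ^ (m + 1) *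
          |V (n + 1) (m + 1) - V (n + 1) 0 * H n (m + 1)| * R ^ m
        = ρ n * (|V (n + 1) (m + 1) - V (n + 1) 0 * H n (m + 1)| *
          ((b (n + 1) / b n) ^ (m + 1) * R ^ m)) := by ring
      _ ≤ D * (|V (n + 1) (m + 1) - V (n + 1) 0 * H n (m + 1)| *
          (E * (R + 1)) ^ (m + 1)) :=
        mul_le_mul (hρD n) (mul_le_mul_of_nonneg_left hpow (abs_nonneg _)) (by positivity) hD.le
      _ ≤ D * (C + C₀ * C₁) := mul_le_mul_of_nonneg_left hdiff hD.le

end Step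

/-- **Proposition 1.** If the Mehler–Heine formula
`(-1)^n (a_n^{1/2}/b_n^{j/2}) p_n^{[j]}(c + z²/b_n) → φ_{ν+j}(z)` holds for `j = 0, 1`,
with `a_n^{-1/2} ≅ A n^a`, `b_n ≅ B n^b`, `2a+1 = b(ν+1)`, and the leading coefficients
satisfy `(γ_n/γ_n^{[1]}) b_n^{1/2}/n → 1/b` and `(γ_n^{[1]}/γ_{n+1}) b_n^{1/2}/n → 1/b`,
then the Mehler–Heine formula holds for every `j ≥ 0`. -/
theorem mehler_heine_all_j
    (μ : Measure ℝ) [IsFiniteMeasure μ]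
    (hsupp : (measSupport μ).Infinite)
    (hint : ∀ p : Polynomial ℝ, Integrable (fun x => p.eval x) μ)
    (c : ℝ)
    (P : ℕ → ℕ → Polynomial ℝ)
    (hP : ∀ j, IsOPS (muMod μ c j) (P j))
    (a b : ℕ → ℝ) (ha : ∀ n, 0 < a n) (hb : ∀ n, 0 < b n)
    (A B bexp : ℝ) (aexp : ℝ) (hA : 0 < A) (hB : 0 < B) (hbexp : 0 < bexp)
    (ν : ℝ) (hν : -1 < ν)
    (haA : Filter.Tendsto (fun n : ℕ => (a n) ^ (-(1 : ℝ) / 2) / (A * (n : ℝ) ^ aexp))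
      Filter.atTop (nhds 1))
    (hbB : Filter.Tendsto (fun n : ℕ => b n / (B * (n : ℝ) ^ bexp)) Filter.atTop (nhds 1))
    (hlink : 2 * aexp + 1 = bexp * (ν + 1))
    (hMH01 : ∀ j : ℕ, j ≤ 1 → ∀ K : Set ℂ, IsCompact K →
      TendstoUniformlyOn
        (fun (n : ℕ) (z : ℂ) =>
          (((-1 : ℝ) ^ n * ((a n) ^ ((1 : ℝ) / 2) / (b n) ^ ((j : ℝ) / 2)) : ℝ) : ℂ) *
            Polynomial.aeval ((c : ℂ) + z ^ 2 / (b n : ℂ)) (P j n))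
        (fun z => phi (ν + j) z) Filter.atTop K)
    (hgamma01 : Filter.Tendsto
      (fun n : ℕ => (P 0 n).leadingCoeff / (P 1 n).leadingCoeff * ((b n) ^ ((1 : ℝ) / 2) / n))
      Filter.atTop (nhds (1 / bexp)))
    (hgamma10 : Filter.Tendsto
      (fun n : ℕ =>
        (P 1 n).leadingCoeff / (P 0 (n + 1)).leadingCoeff * ((b n) ^ ((1 : ℝ) / 2) / n))
      Filter.atTop (nhds (1 / bexp))) :
    ∀ j : ℕ, ∀ K : Set ℂ, IsCompact K →
      TendstoUniformlyOn
        (fun (n : ℕ) (z : ℂ) =>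
          (((-1 : ℝ) ^ n * ((a n) ^ ((1 : ℝ) / 2) / (b n) ^ ((j : ℝ) / 2)) : ℝ) : ℂ) *
            Polynomial.aeval ((c : ℂ) + z ^ 2 / (b n : ℂ)) (P j n))
        (fun z => phi (ν + j) z) Filter.atTop K := by
  have hV : ∀ j : ℕ, CoeffTendsto
      (fun n m => (-1) ^ n * (a n ^ ((1 : ℝ) / 2) / b n ^ ((j : ℝ) / 2)) *
        (taylor c (P j n)).coeff m / b n ^ m) (phiCoeff (ν + j)) := by
    have hν' : ∀ j : ℕ, -1 < ν + j := fun j => by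
      have : (0 : ℝ) ≤ j := j.cast_nonneg
      linarith
    have hbB' : Tendsto (fun n : ℕ => b n / (n : ℝ) ^ bexp) atTop (𝓝 B) := by
      have := hbB.const_mul B
      rw [mul_one] at this
      refine this.congr fun n => ?_
      rw [div_mul_eq_div_div_swap, mul_div_cancel₀ _ hB.ne']
    have haA' : Tendsto (fun n : ℕ => (a n ^ ((1 : ℝ) / 2))⁻¹ / (n : ℝ) ^ aexp) atTop (𝓝 A) := by
      have := haA.const_mul A
      rw [mul_one] at this
      refine this.congr fun n => ?_
      rw [div_mul_eq_div_div_swap, mul_div_cancel₀ _ hA.ne', neg_div, Real.rpow_neg (ha n).le]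
    intro j
    induction j using Nat.twoStepInduction with
    | zero => exact coeffTendsto_of_tendstoUniformlyOn (hν' 0) _ _ _ _ (hMH01 0 (by norm_num))
    | one => exact coeffTendsto_of_tendstoUniformlyOn (hν' 1) _ _ _ _ (hMH01 1 le_rfl)
    | more j ih _ =>
      have h1 := CoeffTendsto.add_two (e := aexp + bexp * (j / 2)) (A := A * B ^ ((j : ℝ) / 2))
        (fun n => div_pos (Real.rpow_pos_of_pos (ha n) _) (Real.rpow_pos_of_pos (hb n) _)) hb
        (by simpa using (hP j).1 0) (by positivity) hB hbexp (hν' j) (by linear_combination hlink)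
        ?_ hbB' ih (taylor_coeff_add_two hint (hP j) (hP (j + 2)))
      · convert! h1 using 1
        · ext n m
          have h2 : b n ^ (((j + 2 : ℕ) : ℝ) / 2) = b n ^ ((j : ℝ) / 2) * b n := by
            rw [← Real.rpow_add_one (hb n).ne']
            congr 1
            push_cast
            ring
          rw [h2, div_div]
        · push_cast
          rw [add_assoc]
      · have h2 := haA'.mul (hbB'.rpow_const (p := (j : ℝ) / 2) (Or.inl hB.ne'))
        refine h2.congr' ?_
        filter_upwards [eventually_gt_atTop 0] with n hn
        have hn' : (0 : ℝ) < n := by exact_mod_cast hn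
        have h3 := Real.rpow_pos_of_pos hn' bexp
        rw [Real.rpow_add hn', Real.rpow_mul hn'.le, Real.div_rpow (hb n).le h3.le, inv_div]
        rw [div_mul_div_comm, div_eq_mul_inv (b n ^ ((j : ℝ) / 2)) (a n ^ ((1 : ℝ) / 2)),
          mul_comm (b n ^ ((j : ℝ) / 2))]
  intro j
  refine tendstoUniformlyOn_of_coeffTendsto ?_ _ _ _ _ (hV j)
  have : (0 : ℝ) ≤ j := j.cast_nonneg
  linarith
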